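/- arXiv:2510.01950 — 8 statements merged into one kernel-verified Lean document; each statement's English description precedes it below -/
import Mathlib

section
/- For every ρ > 0 and all x, y ∈ [0,1], the series Σ_{k=1}^∞ 2·sin(kπy)·sin(kπx)·exp(−k²π²ρ) converges and equals (4πρ)^{−1/2} · Σ_{k∈ℤ} [exp(−(2k + y − x)²/(4ρ)) − exp(−(2k + y + x)²/(4ρ))]. -/
open Real

/-- The kernel ρ̃(x,y) := (4πρ)^{-1/2} · Σ_{n∈ℤ} [exp(−(2n+y−x)²/(4ρ)) − exp(−(2n+y+x)²/(4ρ))]. -/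
noncomputable def rhoTilde (ρ x y : ℝ) : ℝ :=
  (Real.sqrt (4 * π * ρ))⁻¹ *
    ∑' n : ℤ, (Real.exp (-(2 * (n : ℝ) + y - x) ^ 2 / (4 * ρ)) -
      Real.exp (-(2 * (n : ℝ) + y + x) ^ 2 / (4 * ρ)))

/-- The even Hurwitz kernel at time `1 / (πρ)` is a sum of Gaussians of variance `2ρ` over the
translates of `z` by even integers. -/
lemma hasSum_exp_evenKernel {ρ : ℝ} (hρ : 0 < ρ) (z : ℝ) :
    HasSum (fun n : ℤ => Real.exp (-(2 * (n : ℝ) + z) ^ 2 / (4 * ρ)))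
      (HurwitzZeta.evenKernel ((z / 2 : ℝ) : UnitAddCircle) (1 / (π * ρ))) := by
  refine (HurwitzZeta.hasSum_int_evenKernel (z / 2) (by positivity)).congr_fun fun n => ?_
  congr 1
  field_simp
  ring

/-- The Jacobi functional equation at time `πρ`, with the square root normalised as in the
Gaussian heat kernel. -/
lemma cosKernel_eq_evenKernel {ρ : ℝ} (hρ : 0 < ρ) (a : UnitAddCircle) :
    HurwitzZeta.cosKernel a (π * ρ) =
      2 * ((Real.sqrt (4 * π * ρ))⁻¹ * HurwitzZeta.evenKernel a (1 / (π * ρ))) := by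
  have hs : Real.sqrt (4 * π * ρ) = 2 * Real.sqrt (π * ρ) := by
    rw [mul_assoc, Real.sqrt_mul (by norm_num), show (4 : ℝ) = 2 ^ 2 by norm_num,
      Real.sqrt_sq (by norm_num)]
  have hpos : 0 < Real.sqrt (π * ρ) := by positivity
  rw [HurwitzZeta.evenKernel_functional_equation, one_div_one_div, ← Real.sqrt_eq_rpow, hs,
    Real.sqrt_div' _ (by positivity), Real.sqrt_one]
  field_simp

/-- The eigenfunction expansion Σ_{k=1}^∞ 2 sin(kπy) sin(kπx) e^{−k²π²ρ} converges to ρ̃(x,y). -/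
theorem heat_kernel_eigenfunction_expansion (ρ : ℝ) (hρ : 0 < ρ) (x y : ℝ)
    (hx : x ∈ Set.Icc (0 : ℝ) 1) (hy : y ∈ Set.Icc (0 : ℝ) 1) :
    HasSum (fun k : ℕ => 2 * Real.sin (((k : ℝ) + 1) * π * y) * Real.sin (((k : ℝ) + 1) * π * x) *
      Real.exp (-((k : ℝ) + 1) ^ 2 * π ^ 2 * ρ)) (rhoTilde ρ x y) := by
  have hS := ((hasSum_exp_evenKernel hρ (y - x)).sub (hasSum_exp_evenKernel hρ (y + x))).tsum_eq
  simp only [← add_sub_assoc, ← add_assoc] at hS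
  have hC := ((HurwitzZeta.hasSum_nat_cosKernel₀ ((y - x) / 2) (mul_pos pi_pos hρ)).sub
    (HurwitzZeta.hasSum_nat_cosKernel₀ ((y + x) / 2) (mul_pos pi_pos hρ))).div_const 2
  rw [cosKernel_eq_evenKernel hρ, cosKernel_eq_evenKernel hρ] at hC
  rw [rhoTilde, hS]
  convert! hC using 1
  · funext k
    rw [show 2 * π * ((y - x) / 2) * ((k : ℝ) + 1) = (k + 1) * π * y - (k + 1) * π * x by ring,
      show 2 * π * ((y + x) / 2) * ((k : ℝ) + 1) = (k + 1) * π * y + (k + 1) * π * x by ring,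
      Real.cos_sub, Real.cos_add,
      show -π * ((k : ℝ) + 1) ^ 2 * (π * ρ) = -((k : ℝ) + 1) ^ 2 * π ^ 2 * ρ by ring]
    ring
  · ring
end

section
/- For every ρ > 0 and all x₁, x₂ ∈ (0,1), one has |ρ̃(x₁,x₂)| ≤ (πρ)^{−1/2}·exp(−(x₂ − x₁)²/(4ρ)) + π^{3/2}·ρ^{1/2}/6. -/
open Real

/-- The Gaussian `exp (-a ^ 2 / (4 * ρ))` is at most `ρ / k ^ 2` once `|a| ≥ 2 * k`. -/
lemma exp_neg_sq_div_le {ρ a k : ℝ} (hρ : 0 < ρ) (hk : 0 < k) (h : (2 * k) ^ 2 ≤ a ^ 2) :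
    Real.exp (-a ^ 2 / (4 * ρ)) ≤ ρ * (1 / k ^ 2) := by
  have hu : k ^ 2 / ρ ≤ a ^ 2 / (4 * ρ) := by
    rw [div_le_div_iff₀ hρ (by positivity)]
    nlinarith
  calc Real.exp (-a ^ 2 / (4 * ρ)) = (Real.exp (a ^ 2 / (4 * ρ)))⁻¹ := by
        rw [neg_div, Real.exp_neg]
    _ ≤ (k ^ 2 / ρ)⁻¹ := by
        gcongr
        linarith [Real.add_one_le_exp (a ^ 2 / (4 * ρ))]
    _ = ρ * (1 / k ^ 2) := by rw [inv_div, mul_one_div]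

lemma exp_neg_sq_div_le_of_sq_le {ρ a d : ℝ} (hρ : 0 < ρ) (h : d ^ 2 ≤ a ^ 2) :
    Real.exp (-a ^ 2 / (4 * ρ)) ≤ Real.exp (-d ^ 2 / (4 * ρ)) := by
  gcongr

/-- The shifted Basel series `∑ 1 / (n + 1) ^ 2 = π ^ 2 / 6`. -/
lemma hasSum_one_div_add_one_sq :
    HasSum (fun n : ℕ => 1 / ((n : ℝ) + 1) ^ 2) (π ^ 2 / 6) := by
  have h := (hasSum_nat_add_iff' (f := fun n : ℕ => 1 / (n : ℝ) ^ 2) 1).2 hasSum_zeta_two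
  simpa using h

/-- The periodized Gaussian at `t ∈ [0, 2]` converges and is controlled by the Gaussian at any
point `d` no further from the origin than `t` is from `{0, 2}`. -/
lemma summable_and_tsum_exp_le {ρ t d : ℝ} (hρ : 0 < ρ) (hdt : |d| ≤ t) (hdt' : |d| ≤ 2 - t) :
    Summable (fun n : ℤ => Real.exp (-(2 * (n : ℝ) + t) ^ 2 / (4 * ρ))) ∧
      ∑' n : ℤ, Real.exp (-(2 * (n : ℝ) + t) ^ 2 / (4 * ρ)) ≤
        2 * Real.exp (-d ^ 2 / (4 * ρ)) + π ^ 2 * ρ / 3 := by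
  have hd := abs_nonneg d
  set f : ℤ → ℝ := fun n => Real.exp (-(2 * (n : ℝ) + t) ^ 2 / (4 * ρ))
  have hB := hasSum_one_div_add_one_sq.mul_left ρ
  have hpos : ∀ n : ℕ, f ((n + 1 : ℕ) : ℤ) ≤ ρ * (1 / ((n : ℝ) + 1) ^ 2) := by
    intro n
    refine exp_neg_sq_div_le hρ (by positivity) ?_
    push_cast
    gcongr
    linarith
  have hneg : ∀ n : ℕ, f (-(((n + 1 : ℕ) : ℤ) + 1)) ≤ ρ * (1 / ((n : ℝ) + 1) ^ 2) := by
    intro n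
    refine exp_neg_sq_div_le hρ (by positivity) ?_
    rw [← neg_sq (2 * _ + t)]
    push_cast
    gcongr
    linarith
  have hsp : Summable fun n : ℕ => f ((n + 1 : ℕ) : ℤ) :=
    Summable.of_nonneg_of_le (fun _ => (Real.exp_pos _).le) hpos hB.summable
  have hsn : Summable fun n : ℕ => f (-(((n + 1 : ℕ) : ℤ) + 1)) :=
    Summable.of_nonneg_of_le (fun _ => (Real.exp_pos _).le) hneg hB.summable
  have hsp' : Summable fun n : ℕ => f n := (summable_nat_add_iff 1).1 hsp
  have hsn' : Summable fun n : ℕ => f (-((n : ℤ) + 1)) :=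
    (summable_nat_add_iff (f := fun n : ℕ => f (-((n : ℤ) + 1))) 1).1 hsn
  refine ⟨Summable.of_nat_of_neg_add_one hsp' hsn', ?_⟩
  have h0 : f ((0 : ℕ) : ℤ) ≤ Real.exp (-d ^ 2 / (4 * ρ)) := by
    refine exp_neg_sq_div_le_of_sq_le hρ (sq_le_sq.2 ?_)
    exact hdt.trans (by simpa using le_abs_self t)
  have h1 : f (-(((0 : ℕ) : ℤ) + 1)) ≤ Real.exp (-d ^ 2 / (4 * ρ)) := by
    refine exp_neg_sq_div_le_of_sq_le hρ (sq_le_sq.2 ?_)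
    refine hdt'.trans ((le_abs_self _).trans_eq ?_)
    rw [← abs_neg]
    congr 1
    push_cast
    ring
  rw [tsum_of_nat_of_neg_add_one hsp' hsn', hsp'.tsum_eq_zero_add, hsn'.tsum_eq_zero_add]
  have hp := (hsp.tsum_le_tsum hpos hB.summable).trans_eq hB.tsum_eq
  have hn := (hsn.tsum_le_tsum hneg hB.summable).trans_eq hB.tsum_eq
  linarith

/-- Pointwise bound for the kernel ρ̃. -/
theorem rhoTilde_bound (ρ : ℝ) (hρ : 0 < ρ) (x₁ x₂ : ℝ)
    (hx₁ : x₁ ∈ Set.Ioo (0 : ℝ) 1) (hx₂ : x₂ ∈ Set.Ioo (0 : ℝ) 1) :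
    |rhoTilde ρ x₁ x₂| ≤ (Real.sqrt (π * ρ))⁻¹ * Real.exp (-(x₂ - x₁) ^ 2 / (4 * ρ)) +
      π ^ ((3 : ℝ) / 2) * ρ ^ ((1 : ℝ) / 2) / 6 := by
  obtain ⟨h1, h1'⟩ := hx₁
  obtain ⟨h2, h2'⟩ := hx₂
  obtain ⟨hsS, hS⟩ := summable_and_tsum_exp_le (t := x₂ + x₁) (d := x₂ - x₁) hρ
    (abs_le.2 ⟨by linarith, by linarith⟩) (abs_le.2 ⟨by linarith, by linarith⟩)
  have hD : Summable (fun n : ℤ => Real.exp (-(2 * (n : ℝ) + (x₂ - x₁)) ^ 2 / (4 * ρ))) ∧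
      ∑' n : ℤ, Real.exp (-(2 * (n : ℝ) + (x₂ - x₁)) ^ 2 / (4 * ρ)) ≤
        2 * Real.exp (-(x₂ - x₁) ^ 2 / (4 * ρ)) + π ^ 2 * ρ / 3 := by
    rcases le_total 0 (x₂ - x₁) with h | h
    · exact summable_and_tsum_exp_le hρ (abs_of_nonneg h).le
        (by rw [abs_of_nonneg h]; linarith)
    · have key := summable_and_tsum_exp_le (t := -(x₂ - x₁)) (d := x₂ - x₁) hρ
        (abs_of_nonpos h).le (by rw [abs_of_nonpos h]; linarith)
      have hcongr : (fun n : ℤ => Real.exp (-(2 * (n : ℝ) + (x₂ - x₁)) ^ 2 / (4 * ρ))) =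
          (fun n : ℤ => Real.exp (-(2 * (n : ℝ) + -(x₂ - x₁)) ^ 2 / (4 * ρ))) ∘
            Equiv.neg ℤ := by
        funext n
        simp only [Function.comp_apply, Equiv.neg_apply, Int.cast_neg]
        ring_nf
      rw [hcongr]
      exact ⟨(Equiv.summable_iff _).2 key.1, ((Equiv.neg ℤ).tsum_eq _).trans_le key.2⟩
  obtain ⟨hsD, hD⟩ := hD
  have hS0 := tsum_nonneg (L := .unconditional ℤ) (fun n : ℤ =>
    (Real.exp_pos (-(2 * (n : ℝ) + (x₂ + x₁)) ^ 2 / (4 * ρ))).le)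
  have hD0 := tsum_nonneg (L := .unconditional ℤ) (fun n : ℤ =>
    (Real.exp_pos (-(2 * (n : ℝ) + (x₂ - x₁)) ^ 2 / (4 * ρ))).le)
  have hsqrt : Real.sqrt (4 * π * ρ) = 2 * Real.sqrt (π * ρ) := by
    rw [mul_assoc, Real.sqrt_mul (by norm_num), show (4 : ℝ) = 2 ^ 2 by norm_num,
      Real.sqrt_sq (by norm_num)]
  have hconst : π ^ ((3 : ℝ) / 2) * ρ ^ ((1 : ℝ) / 2) / 6 =
      (2 * Real.sqrt (π * ρ))⁻¹ * (π ^ 2 * ρ / 3) := by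
    have hπ := Real.pi_pos
    have e : π ^ ((3 : ℝ) / 2) = π * Real.sqrt π := by
      rw [show (3 : ℝ) / 2 = 1 + 1 / 2 by norm_num, Real.rpow_add hπ, Real.rpow_one,
        Real.sqrt_eq_rpow]
    have hsp := Real.sqrt_pos.2 hπ
    have hsr := Real.sqrt_pos.2 hρ
    rw [e, ← Real.sqrt_eq_rpow, Real.sqrt_mul hπ.le]
    field_simp
    rw [Real.sq_sqrt hπ.le, Real.sq_sqrt hρ.le]
    ring
  have hsum : rhoTilde ρ x₁ x₂ = (2 * Real.sqrt (π * ρ))⁻¹ *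
      (∑' n : ℤ, Real.exp (-(2 * (n : ℝ) + (x₂ - x₁)) ^ 2 / (4 * ρ)) -
        ∑' n : ℤ, Real.exp (-(2 * (n : ℝ) + (x₂ + x₁)) ^ 2 / (4 * ρ))) := by
    rw [← hsD.tsum_sub hsS, rhoTilde, hsqrt]
    simp only [add_sub_assoc, add_assoc]
  have hinv : 0 ≤ (2 * Real.sqrt (π * ρ))⁻¹ := by positivity
  rw [hsum, hconst, abs_mul, abs_of_nonneg hinv]
  calc _ ≤ (2 * Real.sqrt (π * ρ))⁻¹ *
        (2 * Real.exp (-(x₂ - x₁) ^ 2 / (4 * ρ)) + π ^ 2 * ρ / 3) := by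
        gcongr
        exact abs_le.2 ⟨by linarith, by linarith⟩
    _ = _ := by rw [mul_inv]; ring
end

section
/- For every ρ > 0 and all x₁, x₂ ∈ (0,1), one has |𝒦(x₁,x₂)| ≤ (2πρ)^{−1/2}·exp(−(x₂ − x₁)²/(8ρ)) + √2·π^{3/2}·ρ^{1/2}/6. -/
open Real

/-- The covariance kernel 𝒦(x,y) := ∫₀¹ ρ̃(x,z)·ρ̃(z,y) dz. -/
noncomputable def covK (ρ x y : ℝ) : ℝ := ∫ z in (0 : ℝ)..1, rhoTilde ρ x z * rhoTilde ρ z y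

open MeasureTheory

/-- The periodized Gaussian `∑ n : ℤ, exp (-π (n + a)² t)`, as a function of `a : ℝ`. -/
noncomputable def perGauss (t a : ℝ) : ℝ := HurwitzZeta.evenKernel (a : UnitAddCircle) t

lemma hasSum_perGauss {t : ℝ} (ht : 0 < t) (a : ℝ) :
    HasSum (fun n : ℤ ↦ exp (-π * (n + a) ^ 2 * t)) (perGauss t a) :=
  HurwitzZeta.hasSum_int_evenKernel a ht

lemma perGauss_neg (t a : ℝ) : perGauss t (-a) = perGauss t a := by
  simp [perGauss, HurwitzZeta.evenKernel_neg]

lemma perGauss_periodic (t : ℝ) : Function.Periodic (perGauss t) 1 := fun a ↦ by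
  simp [perGauss]

lemma perGauss_add_int (t a : ℝ) (n : ℤ) : perGauss t (a + n) = perGauss t a := by
  simpa using (perGauss_periodic t).int_mul n a

lemma perGauss_abs (t a : ℝ) : perGauss t |a| = perGauss t a := by
  rcases abs_choice a with h | h <;> simp [h, perGauss_neg]

lemma perGauss_nonneg {t : ℝ} (ht : 0 < t) (a : ℝ) : 0 ≤ perGauss t a :=
  (hasSum_perGauss ht a).nonneg fun _ ↦ (exp_pos _).le

lemma continuous_perGauss {t : ℝ} (ht : 0 < t) : Continuous (perGauss t) := by
  have h : Continuous fun a : ℝ ↦ ((perGauss t a : ℝ) : ℂ) := by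
    simp only [perGauss, HurwitzZeta.evenKernel_def]
    have hθ : Continuous fun z : ℂ ↦ jacobiTheta₂ z (Complex.I * t) :=
      continuous_iff_continuousAt.2 fun z ↦
        (differentiableAt_jacobiTheta₂_fst z (by simpa using ht)).continuousAt
    exact (by fun_prop : Continuous fun a : ℝ ↦ Complex.exp (-π * (a : ℂ) ^ 2 * t)).mul
      (hθ.comp (by fun_prop : Continuous fun a : ℝ ↦ (a : ℂ) * Complex.I * t))
  exact Complex.continuous_re.comp h

lemma integral_gaussian_mul_gaussian {t : ℝ} (ht : 0 < t) (a b : ℝ) :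
    Integrable (fun w : ℝ ↦ exp (-π * (w - a) ^ 2 * t) * exp (-π * (w - b) ^ 2 * t)) ∧
    ∫ w : ℝ, exp (-π * (w - a) ^ 2 * t) * exp (-π * (w - b) ^ 2 * t) =
      √(1 / (2 * t)) * exp (-π * (b - a) ^ 2 * (t / 2)) := by
  have key : (fun w : ℝ ↦ exp (-π * (w - a) ^ 2 * t) * exp (-π * (w - b) ^ 2 * t)) =
      fun w ↦ exp (-π * (b - a) ^ 2 * (t / 2)) *
        exp (-(2 * π * t) * (w - (a + b) / 2) ^ 2) := by
    funext w
    rw [← exp_add, ← exp_add]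
    ring_nf
  rw [key]
  constructor
  · exact ((integrable_exp_neg_mul_sq (by positivity)).comp_sub_right _).const_mul _
  · rw [integral_const_mul, integral_sub_right_eq_self (fun w ↦ exp (-(2 * π * t) * w ^ 2)),
      integral_gaussian, mul_comm]
    congr 2
    field_simp

lemma integral_perGauss_mul_gaussian {t : ℝ} (ht : 0 < t) (a b : ℝ) :
    ∫ w : ℝ, perGauss t (w - a) * exp (-π * (w - b) ^ 2 * t) =
      √(1 / (2 * t)) * perGauss (t / 2) (b - a) := by
  have hform : ∀ (n : ℤ) (w : ℝ), exp (-π * (n + (w - a)) ^ 2 * t) * exp (-π * (w - b) ^ 2 * t) =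
      exp (-π * (w - (a - n)) ^ 2 * t) * exp (-π * (w - b) ^ 2 * t) := by
    intro n w
    ring_nf
  have hint : ∀ n : ℤ, ∫ w : ℝ, exp (-π * (n + (w - a)) ^ 2 * t) * exp (-π * (w - b) ^ 2 * t) =
      √(1 / (2 * t)) * exp (-π * (n + (b - a)) ^ 2 * (t / 2)) := by
    intro n
    simp_rw [hform]
    rw [(integral_gaussian_mul_gaussian ht (a - n) b).2]
    ring_nf
  have hsum := (hasSum_perGauss (half_pos ht) (b - a)).mul_left √(1 / (2 * t))
  have h := hasSum_integral_of_summable_integral_norm (μ := volume)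
    (F := fun (n : ℤ) (w : ℝ) ↦ exp (-π * (n + (w - a)) ^ 2 * t) * exp (-π * (w - b) ^ 2 * t))
    (fun n ↦ by
      simp_rw [hform]
      exact (integral_gaussian_mul_gaussian ht (a - n) b).1)
    (by
      simp only [norm_mul, Real.norm_eq_abs, abs_exp, hint]
      exact hsum.summable)
  simp only [hint] at h
  rw [← h.unique hsum]
  congr 1
  funext w
  exact (((hasSum_perGauss ht (w - a)).mul_right _).tsum_eq).symm

lemma integrable_perGauss_mul_gaussian {t : ℝ} (ht : 0 < t) (a b : ℝ) :
    Integrable fun w : ℝ ↦ perGauss t (w - a) * exp (-π * (w - b) ^ 2 * t) := by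
  obtain ⟨C, hC⟩ := ((perGauss_periodic t).isBounded_of_continuous one_ne_zero
    (continuous_perGauss ht)).exists_norm_le
  refine Integrable.bdd_mul (c := C) ?_ ?_ (.of_forall fun w ↦ hC _ ⟨_, rfl⟩)
  · have := (integrable_exp_neg_mul_sq (mul_pos pi_pos ht)).comp_sub_right b
    refine this.congr (.of_forall fun w ↦ ?_)
    ring_nf
  · exact ((continuous_perGauss ht).comp (continuous_id.sub continuous_const)).aestronglyMeasurable

/-- Semigroup property of the heat kernel on the circle. -/
lemma integral_perGauss_mul_perGauss {t : ℝ} (ht : 0 < t) (a b : ℝ) :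
    ∫ w in (0 : ℝ)..1, perGauss t (w - a) * perGauss t (w - b) =
      √(1 / (2 * t)) * perGauss (t / 2) (b - a) := by
  have hcont := continuous_perGauss ht
  have hI := (integrable_perGauss_mul_gaussian ht a b).hasSum_intervalIntegral_comp_add_int
  have hform : ∀ (n : ℤ) (w : ℝ),
      perGauss t (w + n - a) * exp (-π * (w + n - b) ^ 2 * t) =
      perGauss t (w - a) * exp (-π * (n + (w - b)) ^ 2 * t) := by
    intro n w
    rw [add_sub_right_comm, perGauss_add_int]
    ring_nf
  simp only [hform, intervalIntegral.integral_of_le zero_le_one] at hI ⊢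
  have h := hasSum_integral_of_summable_integral_norm (μ := volume.restrict (Set.Ioc 0 1))
    (F := fun (n : ℤ) (w : ℝ) ↦ perGauss t (w - a) * exp (-π * (n + (w - b)) ^ 2 * t))
    (fun n ↦ (Continuous.integrableOn_Ioc (by fun_prop)))
    (by
      simp only [norm_mul, Real.norm_eq_abs, abs_exp, abs_of_nonneg (perGauss_nonneg ht _)]
      exact hI.summable)
  rw [← integral_perGauss_mul_gaussian ht a b, ← h.unique hI]
  congr 1
  funext w
  exact (((hasSum_perGauss ht (w - b)).mul_left _).tsum_eq).symm

lemma perGauss_le {t : ℝ} (ht : 0 < t) {s : ℝ} (hs : s ∈ Set.Icc (0 : ℝ) 1) :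
    perGauss t s ≤ exp (-π * s ^ 2 * t) + exp (-π * (1 - s) ^ 2 * t) + π / (3 * t) := by
  have hsum := (hasSum_perGauss ht s).nat_add_neg_add_one
  have hbound := (hasSum_ite_eq (0 : ℕ)
    (exp (-π * s ^ 2 * t) + exp (-π * (1 - s) ^ 2 * t))).add
      (hasSum_zeta_two.mul_left (2 / (π * t)))
  refine (hasSum_le (fun n ↦ ?_) hsum hbound).trans_eq ?_
  · rcases Nat.eq_zero_or_pos n with rfl | hn
    · simp only [Nat.cast_zero, Int.cast_zero, if_true]
      push_cast
      refine le_of_eq ?_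
      ring_nf
    · have hn' : (0 : ℝ) < n := by exact_mod_cast hn
      have hexp : ∀ u : ℝ, n ≤ u → exp (-π * u ^ 2 * t) ≤ 1 / (π * t) * (1 / (n : ℝ) ^ 2) := by
        intro u hu
        have h1 : π * t * (n : ℝ) ^ 2 ≤ exp (π * u ^ 2 * t) :=
          calc π * t * (n : ℝ) ^ 2 ≤ π * t * u ^ 2 := by gcongr
            _ = π * u ^ 2 * t := by ring
            _ ≤ exp (π * u ^ 2 * t) := by linarith [add_one_le_exp (π * u ^ 2 * t)]
        rw [show -π * u ^ 2 * t = -(π * u ^ 2 * t) by ring, exp_neg, ← one_div,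
          one_div_mul_one_div]
        exact one_div_le_one_div_of_le (by positivity) h1
      have e1 := hexp (n + s) (by linarith [hs.1])
      have e2 := hexp (n + 1 - s) (by linarith [hs.2])
      rw [if_neg hn.ne']
      push_cast
      rw [show (-((n : ℝ) + 1) + s) ^ 2 = (n + 1 - s) ^ 2 by ring]
      calc _ ≤ _ := add_le_add e1 e2
        _ = _ := by ring
  · field_simp
    ring

lemma rhoTilde_eq {ρ : ℝ} (hρ : 0 < ρ) (x y : ℝ) :
    rhoTilde ρ x y = (√(4 * π * ρ))⁻¹ *
      (perGauss (1 / (π * ρ)) (y / 2 - x / 2) - perGauss (1 / (π * ρ)) (y / 2 + x / 2)) := by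
  have ht : 0 < 1 / (π * ρ) := by positivity
  rw [rhoTilde, ← ((hasSum_perGauss ht _).sub (hasSum_perGauss ht _)).tsum_eq]
  congr 2
  funext n
  congr 2 <;> field_simp <;> ring

lemma covK_eq {ρ : ℝ} (hρ : 0 < ρ) (x y : ℝ) :
    covK ρ x y = (√(8 * π * ρ))⁻¹ *
      (perGauss (1 / (2 * π * ρ)) ((y - x) / 2) - perGauss (1 / (2 * π * ρ)) ((x + y) / 2)) := by
  set t := 1 / (π * ρ) with ht_def
  have ht : 0 < t := by positivity
  have hcont := continuous_perGauss ht
  set D : ℝ → ℝ → ℝ := fun a w ↦ perGauss t (w - a) - perGauss t (w + a) with hD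
  have hDcont : ∀ a, Continuous (D a) := fun a ↦ by fun_prop
  have hDrefl : ∀ a w, D a (1 - w) = -D a w := by
    intro a w
    have h1 : perGauss t (1 - w - a) = perGauss t (w + a) := by
      rw [← perGauss_neg, ← perGauss_periodic t]
      ring_nf
    have h2 : perGauss t (1 - w + a) = perGauss t (w - a) := by
      rw [← perGauss_neg, ← perGauss_periodic t]
      ring_nf
    simp [hD, h1, h2]
  have hfold : ∫ w in (0 : ℝ)..1, D (x / 2) w * D (y / 2) w =
      2 * ∫ w in (0 : ℝ)..(1 / 2), D (x / 2) w * D (y / 2) w := by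
    have hc : Continuous fun w ↦ D (x / 2) w * D (y / 2) w :=
      (hDcont (x / 2)).mul (hDcont (y / 2))
    have h := intervalIntegral.integral_comp_sub_left (a := 0) (b := 1 / 2)
      (fun w ↦ D (x / 2) w * D (y / 2) w) 1
    simp only [hDrefl, neg_mul_neg] at h
    rw [← intervalIntegral.integral_add_adjacent_intervals (hc.intervalIntegrable 0 (1 / 2))
      (hc.intervalIntegrable (1 / 2) 1), h]
    norm_num
    rw [two_mul]
  have hexpand : ∫ w in (0 : ℝ)..1, D (x / 2) w * D (y / 2) w =
      2 * √(1 / (2 * t)) * (perGauss (t / 2) ((y - x) / 2) - perGauss (t / 2) ((x + y) / 2)) := by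
    have hi : ∀ a b : ℝ, IntervalIntegrable
        (fun w ↦ perGauss t (w - a) * perGauss t (w - b)) volume 0 1 := fun a b ↦
      Continuous.intervalIntegrable (by fun_prop) _ _
    have hfun : (fun w ↦ D (x / 2) w * D (y / 2) w) = fun w ↦
        (perGauss t (w - x / 2) * perGauss t (w - y / 2) -
          perGauss t (w - x / 2) * perGauss t (w - -(y / 2))) -
        (perGauss t (w - -(x / 2)) * perGauss t (w - y / 2) -
          perGauss t (w - -(x / 2)) * perGauss t (w - -(y / 2))) := by
      funext w
      simp only [hD, sub_neg_eq_add]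
      ring
    rw [hfun, intervalIntegral.integral_sub ((hi _ _).sub (hi _ _)) ((hi _ _).sub (hi _ _)),
      intervalIntegral.integral_sub (hi _ _) (hi _ _),
      intervalIntegral.integral_sub (hi _ _) (hi _ _)]
    simp only [integral_perGauss_mul_perGauss ht]
    rw [← perGauss_neg _ (-(y / 2) - x / 2), ← perGauss_neg _ (-(y / 2) - -(x / 2))]
    ring_nf
  have hcov : covK ρ x y = (4 * π * ρ)⁻¹ * (2 * ∫ w in (0 : ℝ)..(1 / 2),
      D (x / 2) w * D (y / 2) w) := by
    have h := intervalIntegral.integral_comp_div (a := 0) (b := 1)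
      (fun w ↦ D (x / 2) w * D (y / 2) w) (two_ne_zero (α := ℝ))
    rw [zero_div, smul_eq_mul] at h
    rw [← h, covK, ← intervalIntegral.integral_const_mul]
    congr 1
    funext z
    rw [rhoTilde_eq hρ, rhoTilde_eq hρ, ← perGauss_neg _ (y / 2 - z / 2),
      show -(y / 2 - z / 2) = z / 2 - y / 2 by ring, add_comm (y / 2)]
    have hsq : (√(4 * π * ρ))⁻¹ * (√(4 * π * ρ))⁻¹ = (4 * π * ρ)⁻¹ := by
      rw [← mul_inv, mul_self_sqrt (by positivity)]
    rw [← hsq]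
    simp only [hD]
    ring
  have hhalf : t / 2 = 1 / (2 * π * ρ) := by
    rw [ht_def]
    field_simp
  have hconst : (4 * π * ρ)⁻¹ * (2 * √(1 / (2 * t))) = (√(8 * π * ρ))⁻¹ := by
    rw [show 1 / (2 * t) = (2 * π * ρ) ^ 2 / (8 * π * ρ) by rw [ht_def]; field_simp; norm_num,
      sqrt_div (by positivity), sqrt_sq (by positivity)]
    field_simp
    norm_num
  rw [hcov, ← hfold, hexpand, ← hhalf, ← hconst]
  ring

/-- Pointwise bound for the covariance kernel 𝒦. -/
theorem covK_bound (ρ : ℝ) (hρ : 0 < ρ) (x₁ x₂ : ℝ)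
    (hx₁ : x₁ ∈ Set.Ioo (0 : ℝ) 1) (hx₂ : x₂ ∈ Set.Ioo (0 : ℝ) 1) :
    |covK ρ x₁ x₂| ≤ (Real.sqrt (2 * π * ρ))⁻¹ * Real.exp (-(x₂ - x₁) ^ 2 / (8 * ρ)) +
      Real.sqrt 2 * π ^ ((3 : ℝ) / 2) * ρ ^ ((1 : ℝ) / 2) / 6 := by
  obtain ⟨h1, h1'⟩ := hx₁
  obtain ⟨h2, h2'⟩ := hx₂
  set τ := 1 / (2 * π * ρ) with hτ_def
  have hτ : 0 < τ := by positivity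
  set M := 2 * exp (-(x₂ - x₁) ^ 2 / (8 * ρ)) + 2 * π ^ 2 * ρ / 3 with hM
  have hexp : ∀ u : ℝ, |(x₂ - x₁) / 2| ≤ u →
      exp (-π * u ^ 2 * τ) ≤ exp (-(x₂ - x₁) ^ 2 / (8 * ρ)) := by
    intro u hu
    have hsq : ((x₂ - x₁) / 2) ^ 2 ≤ u ^ 2 := sq_le_sq.2 (hu.trans (le_abs_self u))
    rw [show -(x₂ - x₁) ^ 2 / (8 * ρ) = -(π * ((x₂ - x₁) / 2) ^ 2 * τ) by
      rw [hτ_def]; field_simp; ring, show -π * u ^ 2 * τ = -(π * u ^ 2 * τ) by ring]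
    gcongr
  have hle : ∀ s : ℝ, |(x₂ - x₁) / 2| ≤ s → |(x₂ - x₁) / 2| ≤ 1 - s → perGauss τ s ≤ M := by
    intro s hs hs'
    have h0 := abs_nonneg ((x₂ - x₁) / 2)
    have hπ : π / (3 * τ) = 2 * π ^ 2 * ρ / 3 := by
      rw [hτ_def]
      field_simp
    have := perGauss_le hτ (s := s) ⟨by linarith, by linarith⟩
    rw [hπ] at this
    linarith [hexp s hs, hexp (1 - s) hs']
  have hA : perGauss τ ((x₂ - x₁) / 2) ≤ M := by
    rw [← perGauss_abs]
    refine hle _ le_rfl ?_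
    have : |(x₂ - x₁) / 2| ≤ 1 / 2 := abs_le.2 ⟨by linarith, by linarith⟩
    linarith
  have hB : perGauss τ ((x₁ + x₂) / 2) ≤ M :=
    hle _ (abs_le.2 ⟨by linarith, by linarith⟩) (abs_le.2 ⟨by linarith, by linarith⟩)
  have hA0 := perGauss_nonneg hτ ((x₂ - x₁) / 2)
  have hB0 := perGauss_nonneg hτ ((x₁ + x₂) / 2)
  have h8 : √(8 * π * ρ) = 2 * √(2 * π * ρ) := by
    rw [show 8 * π * ρ = 2 ^ 2 * (2 * π * ρ) by ring, sqrt_mul (by positivity),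
      sqrt_sq (by positivity)]
  have htail : √2 * π ^ ((3 : ℝ) / 2) * ρ ^ ((1 : ℝ) / 2) = (√(2 * π * ρ))⁻¹ * (2 * π ^ 2 * ρ) := by
    have hpi : π ^ ((3 : ℝ) / 2) = π * √π := by
      rw [show (3 : ℝ) / 2 = 1 + 1 / 2 by norm_num, rpow_add pi_pos, rpow_one, sqrt_eq_rpow]
    rw [hpi, ← sqrt_eq_rpow, eq_inv_mul_iff_mul_eq₀ (by positivity),
      sqrt_mul (by positivity), sqrt_mul (by positivity)]
    calc _ = (√2 * √2) * (√π * √π) * (√ρ * √ρ) * π := by ring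
      _ = _ := by
        rw [mul_self_sqrt two_pos.le, mul_self_sqrt pi_pos.le, mul_self_sqrt hρ.le]
        ring
  rw [covK_eq hρ, abs_mul, abs_of_pos (by positivity)]
  calc _ ≤ (√(8 * π * ρ))⁻¹ * M := by
        gcongr
        exact abs_le.2 ⟨by linarith, by linarith⟩
    _ = _ := by
        rw [htail, h8, mul_inv, hM]
        ring
end

section
/- For every x ∈ (0,1), lim_{ρ→0⁺} √(4πρ)·|ρ̃(x,x)| = 1 and lim_{ρ→0⁺} √(8πρ)·|𝒦(x,x)| = 1. -/
open Real Filter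

open Topology MeasureTheory

/-- The image sum in `rhoTilde`, without the Gaussian normalisation. -/
noncomputable def imageSum (ρ x y : ℝ) : ℝ :=
  ∑' n : ℤ, (Real.exp (-(2 * (n : ℝ) + y - x) ^ 2 / (4 * ρ)) -
    Real.exp (-(2 * (n : ℝ) + y + x) ^ 2 / (4 * ρ)))

/-- The terms of the image sum with the principal Gaussian removed. -/
noncomputable def imageRemainderTerm (ρ x y : ℝ) (n : ℤ) : ℝ :=
  (if n = 0 then 0 else Real.exp (-(2 * (n : ℝ) + y - x) ^ 2 / (4 * ρ))) -
    Real.exp (-(2 * (n : ℝ) + y + x) ^ 2 / (4 * ρ))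

/-- A summable sequence dominating all image terms except the principal one. -/
noncomputable def imageWeight (n : ℤ) : ℝ := Real.exp (-((n.natAbs : ℝ) - 1) / 4)

lemma summable_imageWeight : Summable imageWeight := by
  have h : Summable fun n : ℕ => Real.exp (-((n : ℝ) - 1) / 4) := by
    have := (Real.summable_exp_nat_mul_iff (a := -1 / 4)).2 (by norm_num)
    refine (this.mul_left (Real.exp (1 / 4))).congr fun n => ?_
    rw [← Real.exp_add]; congr 1; ring
  refine Summable.of_nat_of_neg ?_ ?_ <;> simpa [imageWeight] using h

lemma exp_neg_sq_div_le_s4 {ρ δ q : ℝ} {m : ℕ} (hρ : 0 < ρ) (hρ1 : ρ ≤ 1) (hδ : 0 < δ)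
    (hq : δ + 2 * (m - 1) ≤ |q|) (hqδ : δ ≤ |q|) :
    Real.exp (-q ^ 2 / (4 * ρ)) ≤ 4 * ρ / δ ^ 2 * Real.exp (-((m : ℝ) - 1) / 4) := by
  have hlin : -q ^ 2 / (4 * ρ) ≤ -(δ ^ 2 / (4 * ρ)) + -((m : ℝ) - 1) / 4 := by
    rw [← sq_abs q, neg_div]
    rcases m with _ | k
    · have : δ ^ 2 / (4 * ρ) ≤ |q| ^ 2 / (4 * ρ) := by gcongr
      push_cast; linarith
    · push_cast at hq ⊢
      have hk : (k : ℝ) ≤ (k : ℝ) ^ 2 := by exact_mod_cast Nat.le_self_pow two_ne_zero k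
      have hk0 : (0 : ℝ) ≤ k := k.cast_nonneg
      have h1 : δ ^ 2 + k ≤ |q| ^ 2 := by
        have := pow_le_pow_left₀ (by linarith) hq 2
        nlinarith [mul_nonneg hδ.le hk0]
      have h2 : (δ ^ 2 + k) / (4 * ρ) ≤ |q| ^ 2 / (4 * ρ) := by gcongr
      have h3 : (k : ℝ) / 4 ≤ k / (4 * ρ) := by
        gcongr; linarith
      rw [add_div] at h2
      linarith
  calc _ ≤ Real.exp (-(δ ^ 2 / (4 * ρ)) + -((m : ℝ) - 1) / 4) := Real.exp_le_exp.2 hlin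
    _ = Real.exp (-(δ ^ 2 / (4 * ρ))) * Real.exp (-((m : ℝ) - 1) / 4) := Real.exp_add _ _
    _ ≤ _ := by
      gcongr
      have ht : 0 < δ ^ 2 / (4 * ρ) := by positivity
      rw [Real.exp_neg, ← inv_div (δ ^ 2) (4 * ρ)]
      exact inv_anti₀ ht (by linarith [Real.add_one_le_exp (δ ^ 2 / (4 * ρ))])

section Bounds

variable {ρ δ x y : ℝ}

lemma exp_direct_le (hρ : 0 < ρ) (hρ1 : ρ ≤ 1) (hδ : 0 < δ) (hδx : δ ≤ x) (hδx' : δ ≤ 1 - x)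
    (hy : y ∈ Set.Icc (0 : ℝ) 1) {n : ℤ} (hn : n ≠ 0) :
    Real.exp (-(2 * (n : ℝ) + y - x) ^ 2 / (4 * ρ)) ≤ 4 * ρ / δ ^ 2 * imageWeight n := by
  obtain ⟨hy0, hy1⟩ := hy
  rcases lt_or_gt_of_ne hn with h | h
  · have hc : (n.natAbs : ℝ) = -n := by
      rw [Nat.cast_natAbs, abs_of_neg h]; push_cast; rfl
    have h' : (n : ℝ) ≤ -1 := by exact_mod_cast Int.le_sub_one_of_lt h
    apply exp_neg_sq_div_le_s4 hρ hρ1 hδ <;> rw [abs_of_nonpos (by linarith)] <;> linarith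
  · have hc : (n.natAbs : ℝ) = n := by
      rw [Nat.cast_natAbs, abs_of_pos h]
    have h' : (1 : ℝ) ≤ n := by exact_mod_cast h
    apply exp_neg_sq_div_le_s4 hρ hρ1 hδ <;> rw [abs_of_nonneg (by linarith)] <;> linarith

lemma exp_reflected_le (hρ : 0 < ρ) (hρ1 : ρ ≤ 1) (hδ : 0 < δ) (hδx : δ ≤ x)
    (hδx' : δ ≤ 1 - x) (hy : y ∈ Set.Icc (0 : ℝ) 1) (n : ℤ) :
    Real.exp (-(2 * (n : ℝ) + y + x) ^ 2 / (4 * ρ)) ≤ 4 * ρ / δ ^ 2 * imageWeight n := by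
  obtain ⟨hy0, hy1⟩ := hy
  rcases lt_or_ge n 0 with h | h
  · have hc : (n.natAbs : ℝ) = -n := by
      rw [Nat.cast_natAbs, abs_of_neg h]; push_cast; rfl
    have h' : (n : ℝ) ≤ -1 := by exact_mod_cast Int.le_sub_one_of_lt h
    apply exp_neg_sq_div_le_s4 hρ hρ1 hδ <;> rw [abs_of_nonpos (by linarith)] <;> linarith
  · have hc : (n.natAbs : ℝ) = n := by
      rw [Nat.cast_natAbs, abs_of_nonneg h]
    have h' : (0 : ℝ) ≤ n := by exact_mod_cast h
    apply exp_neg_sq_div_le_s4 hρ hρ1 hδ <;> rw [abs_of_nonneg (by linarith)] <;> linarith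

lemma abs_imageRemainderTerm_le (hρ : 0 < ρ) (hρ1 : ρ ≤ 1) (hδ : 0 < δ) (hδx : δ ≤ x)
    (hδx' : δ ≤ 1 - x) (hy : y ∈ Set.Icc (0 : ℝ) 1) (n : ℤ) :
    |imageRemainderTerm ρ x y n| ≤ 4 * ρ / δ ^ 2 * imageWeight n := by
  have h2 := exp_reflected_le hρ hρ1 hδ hδx hδx' hy n
  have h2' := Real.exp_pos (-(2 * (n : ℝ) + y + x) ^ 2 / (4 * ρ))
  rw [imageRemainderTerm, abs_le]
  split_ifs with hn
  · constructor <;> linarith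
  · have h1 := exp_direct_le hρ hρ1 hδ hδx hδx' hy hn
    have h1' := Real.exp_pos (-(2 * (n : ℝ) + y - x) ^ 2 / (4 * ρ))
    constructor <;> linarith

lemma imageSum_eq (hρ : 0 < ρ) (hρ1 : ρ ≤ 1) (hδ : 0 < δ) (hδx : δ ≤ x)
    (hδx' : δ ≤ 1 - x) (hy : y ∈ Set.Icc (0 : ℝ) 1) :
    imageSum ρ x y =
      Real.exp (-(y - x) ^ 2 / (4 * ρ)) + ∑' n : ℤ, imageRemainderTerm ρ x y n := by
  have hs : Summable (imageRemainderTerm ρ x y) :=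
    .of_norm_bounded (summable_imageWeight.mul_left _)
      (abs_imageRemainderTerm_le hρ hρ1 hδ hδx hδx' hy)
  refine HasSum.tsum_eq ?_
  convert (hasSum_ite_eq (0 : ℤ) (Real.exp (-(y - x) ^ 2 / (4 * ρ)))).add hs.hasSum using 2 with n
  by_cases hn : n = 0
  · subst hn; simp [imageRemainderTerm, sub_eq_add_neg]
  · simp [imageRemainderTerm, hn]

lemma abs_imageSum_sub_le (hρ : 0 < ρ) (hρ1 : ρ ≤ 1) (hδ : 0 < δ) (hδx : δ ≤ x)
    (hδx' : δ ≤ 1 - x) (hy : y ∈ Set.Icc (0 : ℝ) 1) :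
    |imageSum ρ x y - Real.exp (-(y - x) ^ 2 / (4 * ρ))| ≤
      4 / δ ^ 2 * (∑' n, imageWeight n) * ρ := by
  rw [imageSum_eq hρ hρ1 hδ hδx hδx' hy, add_sub_cancel_left]
  refine (tsum_of_norm_bounded (f := imageRemainderTerm ρ x y)
    (summable_imageWeight.mul_left _).hasSum
    (abs_imageRemainderTerm_le hρ hρ1 hδ hδx hδx' hy)).trans_eq ?_
  rw [tsum_mul_left]; ring

lemma continuousOn_imageSum (hρ : 0 < ρ) (hρ1 : ρ ≤ 1) (hδ : 0 < δ) (hδx : δ ≤ x)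
    (hδx' : δ ≤ 1 - x) : ContinuousOn (imageSum ρ x) (Set.Icc 0 1) := by
  refine ContinuousOn.congr (f := fun y => Real.exp (-(y - x) ^ 2 / (4 * ρ)) +
    ∑' n : ℤ, imageRemainderTerm ρ x y n) ?_ fun y hy => imageSum_eq hρ hρ1 hδ hδx hδx' hy
  refine ContinuousOn.add (by fun_prop) ?_
  refine continuousOn_tsum (fun n => ?_) (summable_imageWeight.mul_left (4 * ρ / δ ^ 2))
    fun n y hy => abs_imageRemainderTerm_le hρ hρ1 hδ hδx hδx' hy n
  unfold imageRemainderTerm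
  split_ifs <;> fun_prop

lemma imageSum_comm (hρ : 0 < ρ) (hρ1 : ρ ≤ 1) (hδ : 0 < δ) (hδx : δ ≤ x)
    (hδx' : δ ≤ 1 - x) (hy : y ∈ Set.Icc (0 : ℝ) 1) : imageSum ρ y x = imageSum ρ x y := by
  have hr : Summable fun n : ℤ => Real.exp (-(2 * (n : ℝ) + y + x) ^ 2 / (4 * ρ)) :=
    .of_nonneg_of_le (fun _ => (Real.exp_pos _).le)
      (exp_reflected_le hρ hρ1 hδ hδx hδx' hy) (summable_imageWeight.mul_left _)
  have hd : Summable fun n : ℤ => Real.exp (-(2 * (n : ℝ) + y - x) ^ 2 / (4 * ρ)) := by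
    have hs : Summable (imageRemainderTerm ρ x y) :=
      .of_norm_bounded (summable_imageWeight.mul_left _)
        (abs_imageRemainderTerm_le hρ hρ1 hδ hδx hδx' hy)
    refine ((hasSum_ite_eq (0 : ℤ) (Real.exp (-(y - x) ^ 2 / (4 * ρ)))).summable.add
      (hs.add hr)).congr fun n => ?_
    by_cases hn : n = 0
    · subst hn; simp [imageRemainderTerm]
    · simp [imageRemainderTerm, hn]
  have hd' : Summable fun n : ℤ => Real.exp (-(2 * (n : ℝ) + x - y) ^ 2 / (4 * ρ)) := by
    refine ((Equiv.neg ℤ).summable_iff.2 hd).congr fun n => ?_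
    simp only [Function.comp_apply, Equiv.neg_apply, Int.cast_neg]
    congr 2; ring
  have hswap : ∀ n : ℤ, Real.exp (-(2 * (n : ℝ) + x + y) ^ 2 / (4 * ρ)) =
      Real.exp (-(2 * (n : ℝ) + y + x) ^ 2 / (4 * ρ)) := fun n => by
    rw [add_right_comm]
  unfold imageSum
  simp only [hswap]
  rw [hd.tsum_sub hr, hd'.tsum_sub hr, ← (Equiv.neg ℤ).tsum_eq]
  congr 2 with n
  simp only [Equiv.neg_apply, Int.cast_neg]
  congr 2; ring

lemma abs_integral_imageSum_sq_sub_le (hρ : 0 < ρ) (hρ1 : ρ ≤ 1) (hδ : 0 < δ) (hδx : δ ≤ x)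
    (hδx' : δ ≤ 1 - x) {B : ℝ} (hB : B = 4 / δ ^ 2 * ∑' n, imageWeight n) :
    |(∫ y in (0 : ℝ)..1, imageSum ρ x y ^ 2) -
      ∫ y in (0 : ℝ)..1, Real.exp (-(y - x) ^ 2 / (4 * ρ)) ^ 2| ≤ B * (B + 2) * ρ := by
  have hB0 : 0 ≤ B := by
    rw [hB]; exact mul_nonneg (by positivity) (tsum_nonneg fun n => (Real.exp_pos _).le)
  rw [← intervalIntegral.integral_sub]
  · have h := intervalIntegral.norm_integral_le_of_norm_le_const (a := (0 : ℝ)) (b := 1)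
      (f := fun y => imageSum ρ x y ^ 2 - Real.exp (-(y - x) ^ 2 / (4 * ρ)) ^ 2)
      (C := B * (B + 2) * ρ) ?_
    · simpa using h
    intro y hy
    rw [Set.uIoc_of_le zero_le_one] at hy
    have hd := abs_imageSum_sub_le hρ hρ1 hδ hδx hδx' ⟨hy.1.le, hy.2⟩
    rw [← hB] at hd
    have hg0 := Real.exp_pos (-(y - x) ^ 2 / (4 * ρ))
    have hg1 : Real.exp (-(y - x) ^ 2 / (4 * ρ)) ≤ 1 := by
      rw [Real.exp_le_one_iff, neg_div]
      have : 0 ≤ (y - x) ^ 2 / (4 * ρ) := by positivity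
      linarith
    generalize Real.exp (-(y - x) ^ 2 / (4 * ρ)) = g at *
    have hBρ : B * ρ ≤ B := by nlinarith
    have hsum : |imageSum ρ x y + g| ≤ B + 2 := by
      rw [abs_le] at hd ⊢
      constructor <;> linarith
    rw [Real.norm_eq_abs, sq_sub_sq, abs_mul]
    calc _ ≤ (B + 2) * (B * ρ) := by gcongr
      _ = _ := by ring
  · exact ((continuousOn_imageSum hρ hρ1 hδ hδx hδx').pow 2).intervalIntegrable_of_Icc zero_le_one
  · exact Continuous.intervalIntegrable (by fun_prop) _ _

end Bounds

lemma tendsto_inv_sqrt_nhdsGT_zero :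
    Tendsto (fun ρ : ℝ => (√ρ)⁻¹) (𝓝[>] 0) atTop := by
  refine tendsto_inv_nhdsGT_zero.comp (tendsto_nhdsWithin_iff.2 ⟨?_, ?_⟩)
  · simpa using (Real.continuous_sqrt.tendsto 0).mono_left nhdsWithin_le_nhds
  · filter_upwards [self_mem_nhdsWithin] with ρ hρ using Real.sqrt_pos.2 hρ

lemma tendsto_integral_gaussian_sq {x : ℝ} (hx : x ∈ Set.Ioo (0 : ℝ) 1) :
    Tendsto (fun ρ : ℝ => (√(2 * π * ρ))⁻¹ *
      ∫ y in (0 : ℝ)..1, Real.exp (-(y - x) ^ 2 / (4 * ρ)) ^ 2) (𝓝[>] 0) (𝓝 1) := by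
  have hlim : Tendsto (fun ρ : ℝ => (√(2 * π))⁻¹ *
      ∫ u in ((√ρ)⁻¹ * (0 - x))..((√ρ)⁻¹ * (1 - x)), Real.exp (-(1 / 2) * u ^ 2))
      (𝓝[>] 0) (𝓝 ((√(2 * π))⁻¹ * ∫ u, Real.exp (-(1 / 2) * u ^ 2))) := by
    refine Tendsto.const_mul _ (intervalIntegral_tendsto_integral
      (integrable_exp_neg_mul_sq (by norm_num)) ?_ ?_)
    · exact tendsto_inv_sqrt_nhdsGT_zero.atTop_mul_const_of_neg (by linarith [hx.1])
    · exact tendsto_inv_sqrt_nhdsGT_zero.atTop_mul_const (by linarith [hx.2])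
  have hval : (√(2 * π))⁻¹ * ∫ u, Real.exp (-(1 / 2) * u ^ 2) = 1 := by
    rw [integral_gaussian, show π / (1 / 2) = 2 * π by ring]
    exact inv_mul_cancel₀ (by positivity)
  rw [hval] at hlim
  refine hlim.congr' ?_
  filter_upwards [self_mem_nhdsWithin] with ρ hρ
  have hρ : 0 < ρ := hρ
  have hs : 0 < √ρ := Real.sqrt_pos.2 hρ
  have hsub := intervalIntegral.integral_comp_sub_right (a := (0 : ℝ)) (b := 1)
    (fun t => Real.exp (-(1 / 2) * ((√ρ)⁻¹ * t) ^ 2)) x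
  have hmul := intervalIntegral.integral_comp_mul_left (a := (0 : ℝ) - x) (b := 1 - x)
    (fun u => Real.exp (-(1 / 2) * u ^ 2)) (inv_pos.2 hs).ne'
  have hg : ∀ y : ℝ, Real.exp (-(y - x) ^ 2 / (4 * ρ)) ^ 2 =
      Real.exp (-(1 / 2) * ((√ρ)⁻¹ * (y - x)) ^ 2) := fun y => by
    rw [← Real.exp_nat_mul, mul_pow, inv_pow, Real.sq_sqrt hρ.le]
    congr 1; push_cast; field_simp; ring
  simp only [hg]
  rw [hsub, hmul, inv_inv, smul_eq_mul, Real.sqrt_mul (by positivity : 0 ≤ 2 * π), mul_inv]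
  field_simp

lemma sqrt_mul_rhoTilde {ρ : ℝ} (hρ : 0 < ρ) (x y : ℝ) :
    √(4 * π * ρ) * |rhoTilde ρ x y| = |imageSum ρ x y| := by
  have h : 0 < √(4 * π * ρ) := by positivity
  rw [show rhoTilde ρ x y = (√(4 * π * ρ))⁻¹ * imageSum ρ x y from rfl, abs_mul,
    abs_of_pos (inv_pos.2 h), mul_inv_cancel_left₀ h.ne']

lemma sqrt_mul_covK {ρ δ x : ℝ} (hρ : 0 < ρ) (hρ1 : ρ ≤ 1) (hδ : 0 < δ) (hδx : δ ≤ x)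
    (hδx' : δ ≤ 1 - x) :
    √(8 * π * ρ) * |covK ρ x x| =
      (√(2 * π * ρ))⁻¹ * ∫ y in (0 : ℝ)..1, imageSum ρ x y ^ 2 := by
  have hK : covK ρ x x = (4 * π * ρ)⁻¹ * ∫ y in (0 : ℝ)..1, imageSum ρ x y ^ 2 := by
    rw [covK, ← intervalIntegral.integral_const_mul]
    refine intervalIntegral.integral_congr fun y hy => ?_
    rw [Set.uIcc_of_le zero_le_one] at hy
    change (√(4 * π * ρ))⁻¹ * imageSum ρ x y * ((√(4 * π * ρ))⁻¹ * imageSum ρ y x) = _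
    rw [imageSum_comm hρ hρ1 hδ hδx hδx' hy, mul_mul_mul_comm, ← sq, ← sq, inv_pow,
      Real.sq_sqrt (by positivity)]
  have hI : 0 ≤ ∫ y in (0 : ℝ)..1, imageSum ρ x y ^ 2 :=
    intervalIntegral.integral_nonneg zero_le_one fun y _ => sq_nonneg _
  have hpos : 0 < 2 * π * ρ := by positivity
  have h8 : √(8 * π * ρ) = 2 * √(2 * π * ρ) := by
    rw [show 8 * π * ρ = 2 ^ 2 * (2 * π * ρ) by ring, Real.sqrt_mul (by positivity),
      Real.sqrt_sq (by norm_num)]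
  have h4 : 4 * π * ρ = 2 * √(2 * π * ρ) ^ 2 := by
    rw [Real.sq_sqrt hpos.le]; ring
  have hs : 0 < √(2 * π * ρ) := Real.sqrt_pos.2 hpos
  rw [hK, abs_of_nonneg (by positivity), h8, h4]
  field_simp

/-- Small-ρ diagonal asymptotics of the kernels ρ̃ and 𝒦. -/
theorem diagonal_limits (x : ℝ) (hx : x ∈ Set.Ioo (0 : ℝ) 1) :
    Tendsto (fun ρ : ℝ => Real.sqrt (4 * π * ρ) * |rhoTilde ρ x x|)
      (nhdsWithin 0 (Set.Ioi 0)) (nhds 1) ∧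
    Tendsto (fun ρ : ℝ => Real.sqrt (8 * π * ρ) * |covK ρ x x|)
      (nhdsWithin 0 (Set.Ioi 0)) (nhds 1) := by
  obtain ⟨δ, hδ, hδx, hδx'⟩ : ∃ δ : ℝ, 0 < δ ∧ δ ≤ x ∧ δ ≤ 1 - x :=
    ⟨min x (1 - x), lt_min hx.1 (by linarith [hx.2]), min_le_left _ _, min_le_right _ _⟩
  obtain ⟨B, hB⟩ : ∃ B, B = 4 / δ ^ 2 * ∑' n, imageWeight n := ⟨_, rfl⟩
  have hB0 : 0 ≤ B := by
    rw [hB]; exact mul_nonneg (by positivity) (tsum_nonneg fun n => (Real.exp_pos _).le)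
  have hsmall : ∀ᶠ ρ : ℝ in 𝓝[>] 0, 0 < ρ ∧ ρ ≤ 1 := by
    filter_upwards [Ioc_mem_nhdsGT one_pos] with ρ hρ using hρ
  have hlin : Tendsto (fun ρ : ℝ => B * ρ) (𝓝[>] 0) (𝓝 0) := by
    have : Continuous fun ρ : ℝ => B * ρ := by fun_prop
    simpa using (this.tendsto 0).mono_left nhdsWithin_le_nhds
  have hsqrt : Tendsto (fun ρ : ℝ => B * (B + 2) * √ρ) (𝓝[>] 0) (𝓝 0) := by
    have : Continuous fun ρ : ℝ => B * (B + 2) * √ρ := by fun_prop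
    simpa using (this.tendsto 0).mono_left nhdsWithin_le_nhds
  constructor
  · have h : Tendsto (fun ρ => imageSum ρ x x) (𝓝[>] 0) (𝓝 1) := by
      rw [tendsto_iff_norm_sub_tendsto_zero]
      refine squeeze_zero' (.of_forall fun _ => norm_nonneg _) ?_ hlin
      filter_upwards [hsmall] with ρ hρ
      simpa [← hB] using abs_imageSum_sub_le hρ.1 hρ.2 hδ hδx hδx' ⟨hx.1.le, hx.2.le⟩
    refine Tendsto.congr' ?_ (by simpa using h.abs)
    filter_upwards [hsmall] with ρ hρ using (sqrt_mul_rhoTilde hρ.1 x x).symm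
  · have hdiff : Tendsto (fun ρ : ℝ => (√(2 * π * ρ))⁻¹ *
        ((∫ y in (0 : ℝ)..1, imageSum ρ x y ^ 2) -
          ∫ y in (0 : ℝ)..1, Real.exp (-(y - x) ^ 2 / (4 * ρ)) ^ 2)) (𝓝[>] 0) (𝓝 0) := by
      refine squeeze_zero_norm' ?_ hsqrt
      filter_upwards [hsmall] with ρ hρ
      have hs : 0 < √ρ := Real.sqrt_pos.2 hρ.1
      have hle : √ρ ≤ √(2 * π * ρ) :=
        Real.sqrt_le_sqrt (by nlinarith [Real.pi_gt_three, hρ.1])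
      rw [norm_mul, norm_inv, Real.norm_of_nonneg (Real.sqrt_nonneg _), Real.norm_eq_abs]
      calc _ ≤ (√ρ)⁻¹ * (B * (B + 2) * ρ) :=
            mul_le_mul (inv_anti₀ hs hle)
              (abs_integral_imageSum_sq_sub_le hρ.1 hρ.2 hδ hδx hδx' hB)
              (abs_nonneg _) (by positivity)
        _ = B * (B + 2) * √ρ := by
          nth_rewrite 2 [← Real.mul_self_sqrt hρ.1.le]
          field_simp
    refine Tendsto.congr' ?_ (by simpa using hdiff.add (tendsto_integral_gaussian_sq hx))
    filter_upwards [hsmall] with ρ hρ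
    rw [sqrt_mul_covK hρ.1 hρ.2 hδ hδx hδx']
    ring
end

section
/- For every ρ ∈ (0,1), one has (1/2)·Σ_{k=1}^∞ k²π²·exp(−2k²π²ρ) ≤ 1/(48ρ²). -/
open Real

theorem sq_mul_exp_neg_le_one {x : ℝ} (hx : 0 ≤ x) : x ^ 2 * Real.exp (-x) ≤ 1 := by
  have h₁ : x ≤ Real.exp (x / 2) := by
    have := Real.quadratic_le_exp_of_nonneg (x := x / 2) (by positivity)
    nlinarith [sq_nonneg (x / 2 - 1)]
  have h₂ : x ^ 2 ≤ Real.exp x := by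
    calc x ^ 2 ≤ Real.exp (x / 2) ^ 2 := by gcongr
      _ = Real.exp x := by rw [← Real.exp_nat_mul]; congr 1; push_cast; ring
  rw [Real.exp_neg, ← div_eq_mul_inv]
  exact div_le_one_of_le₀ h₂ (Real.exp_pos x).le

theorem hasSum_one_div_nat_add_one_sq :
    HasSum (fun k : ℕ => 1 / ((k : ℝ) + 1) ^ 2) (π ^ 2 / 6) := by
  simpa using (hasSum_nat_add_iff' 1).mpr hasSum_zeta_two

/-- Bound on the squared Hilbert–Schmidt norm (1/2)·Σ_{k=1}^∞ k²π²·e^{−2k²π²ρ}. -/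
theorem hilbert_schmidt_bound (ρ : ℝ) (hρ : ρ ∈ Set.Ioo (0 : ℝ) 1) :
    (1 / 2) * ∑' k : ℕ, ((k : ℝ) + 1) ^ 2 * π ^ 2 * Real.exp (-2 * ((k : ℝ) + 1) ^ 2 * π ^ 2 * ρ) ≤
      1 / (48 * ρ ^ 2) := by
  have hρ₀ : 0 < ρ := hρ.1
  have hπ : 0 < π := Real.pi_pos
  have hsum := hasSum_one_div_nat_add_one_sq.mul_left (1 / (4 * π ^ 2 * ρ ^ 2))
  have hle : ∀ k : ℕ,
      ((k : ℝ) + 1) ^ 2 * π ^ 2 * Real.exp (-2 * ((k : ℝ) + 1) ^ 2 * π ^ 2 * ρ) ≤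
        1 / (4 * π ^ 2 * ρ ^ 2) * (1 / ((k : ℝ) + 1) ^ 2) := by
    intro k
    have h := sq_mul_exp_neg_le_one (x := 2 * ((k : ℝ) + 1) ^ 2 * π ^ 2 * ρ) (by positivity)
    rw [one_div_mul_one_div, le_div_iff₀ (by positivity)]
    refine le_of_eq_of_le ?_ h
    rw [show -2 * ((k : ℝ) + 1) ^ 2 * π ^ 2 * ρ = -(2 * ((k : ℝ) + 1) ^ 2 * π ^ 2 * ρ) by ring]
    ring
  have hsummable := hsum.summable.of_nonneg_of_le (fun k => by positivity) hle
  calc _ ≤ 1 / 2 * (1 / (4 * π ^ 2 * ρ ^ 2) * (π ^ 2 / 6)) := by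
        gcongr
        exact hasSum_le hle hsummable.hasSum hsum
    _ = 1 / (48 * ρ ^ 2) := by field_simp; norm_num
end

section
/- For every ρ > 0, the function x ↦ ρ̃(x,y) is differentiable on (0,1) for each fixed y ∈ [0,1], and for every integer k ≥ 1 and every x ∈ (0,1), ∫₀¹ ∂ₓρ̃(x,y)·sin(kπy) dy = kπ·exp(−k²π²ρ)·cos(kπx). -/
open Real

/-- Each theta-type coefficient sequence `|m| ^ j * exp (-π² m² ρ)` is summable over `ℤ`. -/
lemma summable_abs_pow_mul_exp_neg_sq (ρ : ℝ) (hρ : 0 < ρ) (j : ℕ) :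
    Summable fun m : ℤ => |(m : ℝ)| ^ j * Real.exp (-(m : ℝ) ^ 2 * π ^ 2 * ρ) := by
  have h := summable_pow_mul_jacobiTheta₂_term_bound 0 (T := π * ρ) (by positivity) j
  refine h.congr fun m => ?_
  push_cast
  congr 2
  ring

lemma summable_shifted_gaussian (ρ : ℝ) (hρ : 0 < ρ) (u : ℝ) :
    Summable fun n : ℤ => Real.exp (-(2 * (n : ℝ) + u) ^ 2 / (4 * ρ)) := by
  have h := summable_pow_mul_jacobiTheta₂_term_bound (|u| / (2 * π * ρ))
    (T := (π * ρ)⁻¹) (by positivity) 0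
  refine h.of_nonneg_of_le (fun _ => (Real.exp_pos _).le) fun n => ?_
  rw [pow_zero, one_mul, Real.exp_le_exp]
  push_cast
  have hu : -((n : ℝ) * u) ≤ |(n : ℝ)| * |u| := by
    rw [← abs_mul]; exact neg_le_abs _
  have e : -π * ((π * ρ)⁻¹ * (n : ℝ) ^ 2 - 2 * (|u| / (2 * π * ρ)) * |(n : ℝ)|)
      = (-4 * (n : ℝ) ^ 2 + 4 * (|(n : ℝ)| * |u|)) / (4 * ρ) := by
    field_simp
    ring
  rw [e]
  gcongr
  nlinarith [sq_nonneg u]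

/-- Poisson summation for the Gaussian with period `2`. -/
lemma tsum_shifted_gaussian (ρ : ℝ) (hρ : 0 < ρ) (u : ℝ) :
    (Real.sqrt (4 * π * ρ))⁻¹ * ∑' n : ℤ, Real.exp (-(2 * (n : ℝ) + u) ^ 2 / (4 * ρ)) =
      ∑' m : ℤ, Real.exp (-(m : ℝ) ^ 2 * π ^ 2 * ρ) * (Real.cos (m * π * u) / 2) := by
  have h := Complex.tsum_exp_neg_quadratic (a := ((π * ρ : ℝ) : ℂ))
    (by rw [Complex.ofReal_re]; positivity) (-Complex.I * (u / 2 : ℝ))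
  have hL : ∀ m : ℤ, Complex.exp (-π * ((π * ρ : ℝ) : ℂ) * (m : ℂ) ^ 2 +
      2 * π * (-Complex.I * (u / 2 : ℝ)) * m) =
      (Real.exp (-(m : ℝ) ^ 2 * π ^ 2 * ρ) : ℂ) *
        Complex.exp ((-(m * π * u) : ℝ) * Complex.I) := by
    intro m
    rw [Complex.ofReal_exp, ← Complex.exp_add]
    congr 1
    push_cast
    ring
  have hR : ∀ n : ℤ, Complex.exp (-π / ((π * ρ : ℝ) : ℂ) *
      ((n : ℂ) + Complex.I * (-Complex.I * (u / 2 : ℝ))) ^ 2) =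
      (Real.exp (-(2 * (n : ℝ) + u) ^ 2 / (4 * ρ)) : ℂ) := by
    intro n
    rw [Complex.ofReal_exp]
    congr 1
    have h1 : (ρ : ℂ) ≠ 0 := by exact_mod_cast hρ.ne'
    have h2 : (π : ℂ) ≠ 0 := by exact_mod_cast pi_ne_zero
    have h3 : Complex.I * (-Complex.I * (u / 2 : ℝ)) = ((u / 2 : ℝ) : ℂ) := by
      rw [← mul_assoc, mul_neg, Complex.I_mul_I]; simp
    rw [h3]
    push_cast
    field_simp
    ring
  simp_rw [hL, hR] at h
  have hs : Summable fun m : ℤ => (Real.exp (-(m : ℝ) ^ 2 * π ^ 2 * ρ) : ℂ) *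
        Complex.exp ((-(m * π * u) : ℝ) * Complex.I) := by
    refine Summable.of_norm ?_
    simp_rw [norm_mul, Complex.norm_exp_ofReal_mul_I, Complex.norm_real, Real.norm_eq_abs,
      Real.abs_exp]
    simpa using summable_abs_pow_mul_exp_neg_sq ρ hρ 0
  have hroot : 1 / ((π * ρ : ℝ) : ℂ) ^ (1 / 2 : ℂ) = (((Real.sqrt (π * ρ))⁻¹ : ℝ) : ℂ) := by
    rw [Real.sqrt_eq_rpow, Complex.ofReal_inv, Complex.ofReal_cpow (by positivity), one_div]
    norm_num
  rw [hroot, ← Complex.ofReal_tsum, ← Complex.ofReal_mul] at h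
  have h' := congrArg Complex.re h
  rw [Complex.ofReal_re, Complex.re_tsum hs] at h'
  simp_rw [Complex.re_ofReal_mul, Complex.exp_ofReal_mul_I_re, Real.cos_neg] at h'
  have h4 : Real.sqrt (4 * π * ρ) = 2 * Real.sqrt (π * ρ) := by
    rw [mul_assoc, Real.sqrt_mul (by norm_num), show (4 : ℝ) = 2 ^ 2 by norm_num,
      Real.sqrt_sq (by norm_num)]
  simp_rw [← mul_div_assoc]
  rw [tsum_div_const, h', h4, mul_inv]
  ring

/-- The sine expansion of the Dirichlet heat kernel. -/
lemma rhoTilde_eq_tsum_sin (ρ : ℝ) (hρ : 0 < ρ) (x y : ℝ) :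
    rhoTilde ρ x y = ∑' m : ℤ, Real.exp (-(m : ℝ) ^ 2 * π ^ 2 * ρ) *
      (Real.sin (m * π * x) * Real.sin (m * π * y)) := by
  have hc : ∀ u : ℝ, Summable fun m : ℤ =>
      Real.exp (-(m : ℝ) ^ 2 * π ^ 2 * ρ) * (Real.cos (m * π * u) / 2) := by
    intro u
    refine Summable.of_norm_bounded (summable_abs_pow_mul_exp_neg_sq ρ hρ 0) fun m => ?_
    rw [norm_mul, Real.norm_eq_abs, Real.abs_exp, pow_zero, one_mul]
    refine mul_le_of_le_one_right (Real.exp_pos _).le ?_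
    rw [Real.norm_eq_abs, abs_div, abs_two]
    linarith [Real.abs_cos_le_one (m * π * u)]
  unfold rhoTilde
  simp_rw [add_sub_assoc, add_assoc]
  rw [(summable_shifted_gaussian ρ hρ (y - x)).tsum_sub (summable_shifted_gaussian ρ hρ (y + x)),
    mul_sub, tsum_shifted_gaussian ρ hρ, tsum_shifted_gaussian ρ hρ, ← (hc _).tsum_sub (hc _)]
  refine tsum_congr fun m => ?_
  rw [mul_sub (_ * π), mul_add (_ * π), Real.cos_sub, Real.cos_add]
  ring

/-- Termwise differentiation of the sine expansion. -/
lemma hasDerivAt_rhoTilde (ρ : ℝ) (hρ : 0 < ρ) (x y : ℝ) :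
    HasDerivAt (fun x' => rhoTilde ρ x' y)
      (∑' m : ℤ, Real.exp (-(m : ℝ) ^ 2 * π ^ 2 * ρ) *
        (m * π * Real.cos (m * π * x) * Real.sin (m * π * y))) x := by
  simp_rw [rhoTilde_eq_tsum_sin ρ hρ]
  refine hasDerivAt_tsum ((summable_abs_pow_mul_exp_neg_sq ρ hρ 1).mul_left π)
    (g := fun (m : ℤ) x => Real.exp (-(m : ℝ) ^ 2 * π ^ 2 * ρ) *
      (Real.sin (m * π * x) * Real.sin (m * π * y)))
    (g' := fun (m : ℤ) x => Real.exp (-(m : ℝ) ^ 2 * π ^ 2 * ρ) *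
      (m * π * Real.cos (m * π * x) * Real.sin (m * π * y)))
    (y₀ := 0) (fun m z => ?_) (fun m z => ?_) ?_ x
  · have h := ((((hasDerivAt_id z).const_mul (m * π : ℝ)).sin).mul_const
      (Real.sin (m * π * y))).const_mul (Real.exp (-(m : ℝ) ^ 2 * π ^ 2 * ρ))
    refine h.congr_deriv ?_
    simp only [id]
    ring
  · rw [Real.norm_eq_abs]
    simp only [abs_mul, Real.abs_exp, abs_of_pos pi_pos, pow_one]
    have h1 := mul_le_one₀ (Real.abs_cos_le_one (m * π * z)) (abs_nonneg _)
      (Real.abs_sin_le_one (m * π * y))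
    calc _ = π * (|(m : ℝ)| * Real.exp (-(m : ℝ) ^ 2 * π ^ 2 * ρ)) *
        (|Real.cos (m * π * z)| * |Real.sin (m * π * y)|) := by ring
      _ ≤ _ := mul_le_of_le_one_right (by positivity) h1
  · simp

lemma integral_cos_int_mul_pi (j : ℤ) :
    ∫ y in (0 : ℝ)..1, Real.cos (j * π * y) = if j = 0 then 1 else 0 := by
  split_ifs with hj
  · simp [hj]
  · have hne : (j * π : ℝ) ≠ 0 := mul_ne_zero (by exact_mod_cast hj) pi_ne_zero
    rw [intervalIntegral.integral_comp_mul_left _ hne, integral_cos]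
    simp [Real.sin_int_mul_pi]

lemma integral_sin_mul_sin_int_mul_pi (m k : ℤ) :
    ∫ y in (0 : ℝ)..1, Real.sin (m * π * y) * Real.sin (k * π * y) =
      ((if m = k then 1 else 0) - (if m = -k then 1 else 0)) / 2 := by
  have h : ∀ y : ℝ, Real.sin (m * π * y) * Real.sin (k * π * y) =
      (Real.cos ((m - k : ℤ) * π * y) - Real.cos ((m + k : ℤ) * π * y)) / 2 := by
    intro y
    push_cast
    rw [sub_mul, sub_mul, add_mul, add_mul, Real.cos_sub, Real.cos_add]
    ring
  simp_rw [h]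
  rw [intervalIntegral.integral_div, intervalIntegral.integral_sub
    (Continuous.intervalIntegrable (by fun_prop) _ _)
    (Continuous.intervalIntegrable (by fun_prop) _ _),
    integral_cos_int_mul_pi, integral_cos_int_mul_pi]
  simp only [sub_eq_zero, add_eq_zero_iff_eq_neg]

/-- ρ̃ is differentiable in its first argument, and the integral operator with kernel ∂ₓρ̃ maps
sin(kπ·) to kπ·e^{−k²π²ρ}·cos(kπx). -/
theorem rhoTilde_deriv_eigenfunction (ρ : ℝ) (hρ : 0 < ρ) :
    (∀ y ∈ Set.Icc (0 : ℝ) 1, ∀ x ∈ Set.Ioo (0 : ℝ) 1,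
      DifferentiableAt ℝ (fun x' => rhoTilde ρ x' y) x) ∧
    (∀ k : ℕ, 1 ≤ k → ∀ x ∈ Set.Ioo (0 : ℝ) 1,
      ∫ y in (0 : ℝ)..1, deriv (fun x' => rhoTilde ρ x' y) x * Real.sin ((k : ℝ) * π * y) =
        (k : ℝ) * π * Real.exp (-(k : ℝ) ^ 2 * π ^ 2 * ρ) * Real.cos ((k : ℝ) * π * x)) := by
  refine ⟨fun y _ x _ => (hasDerivAt_rhoTilde ρ hρ x y).differentiableAt, fun k _ x _ => ?_⟩
  simp_rw [(hasDerivAt_rhoTilde ρ hρ x _).deriv, ← tsum_mul_right]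
  set a : ℤ → ℝ := fun m =>
    Real.exp (-(m : ℝ) ^ 2 * π ^ 2 * ρ) * (m * π * Real.cos (m * π * x)) with ha
  have hbound : ∀ (m : ℤ) (y : ℝ), ‖a m * (Real.sin (m * π * y) * Real.sin (k * π * y))‖ ≤
      π * (|(m : ℝ)| ^ 1 * Real.exp (-(m : ℝ) ^ 2 * π ^ 2 * ρ)) := by
    intro m y
    rw [Real.norm_eq_abs]
    simp only [ha, abs_mul, Real.abs_exp, abs_of_pos pi_pos, pow_one]
    have h1 := mul_le_one₀ (Real.abs_cos_le_one (m * π * x)) (by positivity)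
      (mul_le_one₀ (Real.abs_sin_le_one (m * π * y)) (abs_nonneg _)
        (Real.abs_sin_le_one (k * π * y)))
    calc _ = π * (|(m : ℝ)| * Real.exp (-(m : ℝ) ^ 2 * π ^ 2 * ρ)) *
        (|Real.cos (m * π * x)| * (|Real.sin (m * π * y)| * |Real.sin (k * π * y)|)) := by ring
      _ ≤ _ := mul_le_of_le_one_right (by positivity) h1
  have hsum := (summable_abs_pow_mul_exp_neg_sq ρ hρ 1).mul_left π
  have hswap := intervalIntegral.hasSum_integral_of_dominated_convergence
    (μ := MeasureTheory.volume) (a := 0) (b := 1)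
    (F := fun (m : ℤ) y => a m * (Real.sin (m * π * y) * Real.sin (k * π * y)))
    (f := fun y => ∑' m : ℤ, a m * (Real.sin (m * π * y) * Real.sin (k * π * y)))
    (fun m _ => π * (|(m : ℝ)| ^ 1 * Real.exp (-(m : ℝ) ^ 2 * π ^ 2 * ρ)))
    (fun m => Continuous.aestronglyMeasurable (by fun_prop))
    (fun m => Filter.Eventually.of_forall fun y _ => hbound m y)
    (Filter.Eventually.of_forall fun _ _ => hsum)
    (by simp)
    (Filter.Eventually.of_forall fun y _ =>
      (Summable.of_norm_bounded hsum fun m => hbound m y).hasSum)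
  have horth : ∀ m : ℤ, ∫ y in (0 : ℝ)..1, a m * (Real.sin (m * π * y) * Real.sin (k * π * y)) =
      (if m = (k : ℤ) then a k / 2 else 0) + (if m = -(k : ℤ) then -a (-k) / 2 else 0) := by
    intro m
    have h := integral_sin_mul_sin_int_mul_pi m k
    push_cast at h
    have hpos : (if m = (k : ℤ) then a k / 2 else 0) =
        a m * (if m = (k : ℤ) then 1 else 0) / 2 := by
      split_ifs with hm <;> simp [hm]
    have hneg : (if m = -(k : ℤ) then -a (-k) / 2 else 0) =
        -(a m * (if m = -(k : ℤ) then 1 else 0)) / 2 := by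
      split_ifs with hm <;> simp [hm]
    rw [intervalIntegral.integral_const_mul, h, hpos, hneg]
    ring
  simp_rw [horth] at hswap
  have htotal := hswap.unique
    ((hasSum_ite_eq (k : ℤ) (a k / 2)).add (hasSum_ite_eq (-(k : ℤ)) (-a (-k) / 2)))
  calc _ = ∫ y in (0 : ℝ)..1,
        ∑' m : ℤ, a m * (Real.sin (m * π * y) * Real.sin (k * π * y)) := by
        simp only [ha, mul_assoc]
    _ = a k / 2 + -a (-k) / 2 := htotal
    _ = _ := by
        simp only [ha]
        push_cast
        rw [neg_sq, neg_mul (k : ℝ) π, neg_mul ((k : ℝ) * π) x, Real.cos_neg]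
        ring
end

section
/- For every ε with 0 < ε ≤ 1 and every δ > 0, the function U_{ε,δ} is continuously differentiable on ℝ and its derivative satisfies −1/ε ≤ U′_{ε,δ}(x) ≤ −ε for every x ∈ ℝ. -/
open Real

/-- The bump function J̃(x) = Ĵ·exp(−1/(1−x²)) for |x| < 1, and 0 otherwise. -/
noncomputable def Jtilde (Jhat x : ℝ) : ℝ :=
  if |x| < 1 then Jhat * Real.exp (-1 / (1 - x ^ 2)) else 0

/-- The mollifier J^δ(x) = δ⁻¹·J̃(x/δ). -/
noncomputable def Jmoll (Jhat δ x : ℝ) : ℝ := δ⁻¹ * Jtilde Jhat (x / δ)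

/-- The inverse g_ε⁻¹ of the regularized sign function. -/
noncomputable def gInv (ε x : ℝ) : ℝ :=
  if 1 ≤ x then x / ε + ε - 1 / ε
  else if x ≤ -1 then x / ε - ε + 1 / ε
  else ε * x

/-- U_{ε,δ}(x) := −(J^δ ∗ g_ε⁻¹)(x), the negative of the mollification of g_ε⁻¹. -/
noncomputable def Ureg (Jhat ε δ x : ℝ) : ℝ := -∫ y : ℝ, Jmoll Jhat δ y * gInv ε (x - y)

open MeasureTheory

theorem Jtilde_eq_expNegInvGlue (Jhat x : ℝ) :
    Jtilde Jhat x = Jhat * expNegInvGlue (1 - x ^ 2) := by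
  have h : |x| < 1 ↔ ¬ (1 - x ^ 2 ≤ 0) := by
    rw [← sq_lt_one_iff_abs_lt_one, not_le, sub_pos]
  by_cases hx : |x| < 1
  · rw [Jtilde, if_pos hx, expNegInvGlue, if_neg (h.1 hx), neg_div, one_div]
  · rw [Jtilde, if_neg hx, expNegInvGlue, if_pos (not_not.1 (mt h.2 hx)), mul_zero]

theorem Jmoll_contDiff (Jhat δ : ℝ) : ContDiff ℝ 1 (Jmoll Jhat δ) := by
  have h : Jmoll Jhat δ = fun x => δ⁻¹ * (Jhat * expNegInvGlue (1 - (x / δ) ^ 2)) := by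
    funext x
    rw [Jmoll, Jtilde_eq_expNegInvGlue]
  rw [h]
  exact contDiff_const.mul (contDiff_const.mul (expNegInvGlue.contDiff.comp
    (contDiff_const.sub ((contDiff_id.div_const δ).pow 2))))

theorem Jmoll_hasCompactSupport {Jhat δ : ℝ} (hδ : 0 < δ) :
    HasCompactSupport (Jmoll Jhat δ) := by
  refine HasCompactSupport.intro (isCompact_Icc (a := -δ) (b := δ)) fun x hx => ?_
  have h : ¬ |x / δ| < 1 := by
    rw [abs_div, abs_of_pos hδ, div_lt_one hδ]
    exact fun h => hx (abs_le.1 h.le)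
  rw [Jmoll, Jtilde, if_neg h, mul_zero]

theorem Jmoll_nonneg {Jhat δ : ℝ} (hJhat : 0 ≤ Jhat) (hδ : 0 < δ) (x : ℝ) :
    0 ≤ Jmoll Jhat δ x := by
  rw [Jmoll, Jtilde]
  split_ifs <;> positivity

theorem integral_Jmoll {Jhat δ : ℝ} (hδ : 0 < δ) (hnorm : ∫ x : ℝ, Jtilde Jhat x = 1) :
    ∫ x : ℝ, Jmoll Jhat δ x = 1 := by
  simp only [Jmoll]
  rw [integral_const_mul, Measure.integral_comp_div, hnorm, abs_of_pos hδ, smul_eq_mul, mul_one,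
    inv_mul_cancel₀ hδ.ne']

theorem gInv_eq_max_min (ε x : ℝ) :
    gInv ε x = ε * x + (1 / ε - ε) * (max (x - 1) 0 + min (x + 1) 0) := by
  rw [gInv]
  split_ifs with h₁ h₂
  · rw [max_eq_left (by linarith), min_eq_right (by linarith)]
    ring
  · rw [max_eq_right (by linarith), min_eq_left (by linarith)]
    ring
  · rw [max_eq_right (by linarith), min_eq_right (by linarith)]
    ring

theorem gInv_continuous (ε : ℝ) : Continuous (gInv ε) := by
  rw [show gInv ε = _ from funext (gInv_eq_max_min ε)]
  fun_prop

theorem gInv_sub_bounds {ε : ℝ} (hε : 0 < ε) (hε1 : ε ≤ 1) {a b : ℝ} (hab : a ≤ b) :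
    ε * (b - a) ≤ gInv ε b - gInv ε a ∧ gInv ε b - gInv ε a ≤ 1 / ε * (b - a) := by
  have hc : 0 ≤ 1 / ε - ε := by
    have : 1 ≤ 1 / ε := (one_le_div hε).2 hε1
    linarith
  have hd : 0 ≤ max (b - 1) 0 + min (b + 1) 0 - (max (a - 1) 0 + min (a + 1) 0) ∧
      max (b - 1) 0 + min (b + 1) 0 - (max (a - 1) 0 + min (a + 1) 0) ≤ b - a := by
    grind
  rw [gInv_eq_max_min, gInv_eq_max_min]
  constructor
  · linarith [mul_nonneg hc hd.1]
  · linarith [mul_le_mul_of_nonneg_left hd.2 hc]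

theorem Ureg_contDiff {Jhat ε δ : ℝ} (hδ : 0 < δ) : ContDiff ℝ 1 (Ureg Jhat ε δ) :=
  ((Jmoll_hasCompactSupport hδ).contDiff_convolution_left (ContinuousLinearMap.mul ℝ ℝ)
    (Jmoll_contDiff Jhat δ) ((gInv_continuous ε).locallyIntegrable (μ := volume))).neg

theorem Ureg_sub_bounds {ε δ Jhat : ℝ} (hε : 0 < ε) (hε1 : ε ≤ 1) (hδ : 0 < δ)
    (hJhat : 0 < Jhat) (hnorm : ∫ x : ℝ, Jtilde Jhat x = 1) {a b : ℝ} (hab : a ≤ b) :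
    ε * (b - a) ≤ Ureg Jhat ε δ a - Ureg Jhat ε δ b ∧
      Ureg Jhat ε δ a - Ureg Jhat ε δ b ≤ 1 / ε * (b - a) := by
  have hJc := (Jmoll_contDiff Jhat δ).continuous
  have hJs := Jmoll_hasCompactSupport (Jhat := Jhat) hδ
  have hJi : Integrable (Jmoll Jhat δ) := hJc.integrable_of_hasCompactSupport hJs
  have hi (x : ℝ) : Integrable fun y => Jmoll Jhat δ y * gInv ε (x - y) :=
    (hJc.mul ((gInv_continuous ε).comp (continuous_const.sub continuous_id))
      ).integrable_of_hasCompactSupport hJs.mul_right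
  have hsub : Ureg Jhat ε δ a - Ureg Jhat ε δ b =
      ∫ y, (Jmoll Jhat δ y * gInv ε (b - y) - Jmoll Jhat δ y * gInv ε (a - y)) := by
    rw [integral_sub (hi b) (hi a), Ureg, Ureg]
    ring
  have hconst (c : ℝ) : c = ∫ y, Jmoll Jhat δ y * c := by
    rw [integral_mul_const, integral_Jmoll hδ hnorm, one_mul]
  have hg (y : ℝ) := gInv_sub_bounds hε hε1 (sub_le_sub_right hab y)
  simp only [sub_sub_sub_cancel_right] at hg
  rw [hsub, hconst (ε * (b - a)), hconst (1 / ε * (b - a))]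
  constructor
  · refine integral_mono (hJi.mul_const _) ((hi b).sub (hi a)) fun y => ?_
    simp only [← mul_sub]
    exact mul_le_mul_of_nonneg_left (hg y).1 (Jmoll_nonneg hJhat.le hδ y)
  · refine integral_mono ((hi b).sub (hi a)) (hJi.mul_const _) fun y => ?_
    simp only [← mul_sub]
    exact mul_le_mul_of_nonneg_left (hg y).2 (Jmoll_nonneg hJhat.le hδ y)

/-- U_{ε,δ} is C¹ with derivative pinched between −1/ε and −ε. -/
theorem Ureg_contDiff_and_deriv_bounds (ε δ Jhat : ℝ) (hε : 0 < ε) (hε1 : ε ≤ 1) (hδ : 0 < δ)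
    (hJhat : 0 < Jhat) (hnorm : ∫ x : ℝ, Jtilde Jhat x = 1) :
    ContDiff ℝ 1 (Ureg Jhat ε δ) ∧
    ∀ x : ℝ, -(1 / ε) ≤ deriv (Ureg Jhat ε δ) x ∧ deriv (Ureg Jhat ε δ) x ≤ -ε := by
  refine ⟨Ureg_contDiff hδ, fun x => ?_⟩
  have hU : HasDerivAt (Ureg Jhat ε δ) (deriv (Ureg Jhat ε δ) x) x :=
    ((Ureg_contDiff hδ).differentiable one_ne_zero x).hasDerivAt
  have hderiv (c : ℝ) : HasDerivAt (fun t => Ureg Jhat ε δ t + c * t)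
      (deriv (Ureg Jhat ε δ) x + c) x := by
    simpa using hU.fun_add ((hasDerivAt_id x).const_mul c)
  have hmono : Monotone fun t => Ureg Jhat ε δ t + 1 / ε * t := fun a b hab => by
    have := (Ureg_sub_bounds hε hε1 hδ hJhat hnorm hab).2
    simp only
    linarith
  have hanti : Antitone fun t => Ureg Jhat ε δ t + ε * t := fun a b hab => by
    have := (Ureg_sub_bounds hε hε1 hδ hJhat hnorm hab).1
    simp only
    linarith
  have h₁ := hmono.deriv_nonneg (x := x)
  have h₂ := hanti.deriv_nonpos (x := x)
  rw [(hderiv _).deriv] at h₁ h₂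
  constructor <;> linarith
end

section
/- Let n ≥ 1 be an integer, T > 0, and c ∈ ℝ. Let A : [0,T] → (n×n real matrices) be continuous with each A(s) symmetric and (c/2)·I − A(s) positive semidefinite for all s ∈ [0,T]. Let J : [0,T] → (n×n real matrices) be differentiable with J(T) = I and J′(s) = −J(s)·A(s) for all s ∈ [0,T]. Then for every s ∈ [0,T] and every y ∈ ℝⁿ, ‖J(s)ᵀ·y‖² ≤ exp(c·(T − s))·‖y‖², where ‖·‖ is the Euclidean norm on ℝⁿ. -/
open Real Matrix

/-- If `A ≤ a • 1` in the Loewner order, then `v ⬝ᵥ A *ᵥ v ≤ a * (v ⬝ᵥ v)`. -/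
lemma dotProduct_mulVec_le_of_posSemidef {ι : Type*} [Fintype ι] [DecidableEq ι]
    {A : Matrix ι ι ℝ} {a : ℝ} (h : (a • (1 : Matrix ι ι ℝ) - A).PosSemidef) (v : ι → ℝ) :
    v ⬝ᵥ A *ᵥ v ≤ a * (v ⬝ᵥ v) := by
  have := h.dotProduct_mulVec_nonneg v
  simp only [star_trivial, sub_mulVec, smul_mulVec, one_mulVec, dotProduct_sub,
    dotProduct_smul, smul_eq_mul] at this
  linarith

/-- Along a solution of `v' = -A v` with `A ≤ (c / 2) • 1`, the weighted squared norm
`exp (c * s) * (v s ⬝ᵥ v s)` is nondecreasing. -/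
lemma monotoneOn_exp_mul_dotProduct_self {ι : Type*} [Fintype ι] [DecidableEq ι]
    {D : Set ℝ} (hD : Convex ℝ D) {c : ℝ} {A : ℝ → Matrix ι ι ℝ} {v : ℝ → ι → ℝ}
    (hA : ∀ s ∈ D, ((c / 2) • (1 : Matrix ι ι ℝ) - A s).PosSemidef)
    (hv : ∀ s ∈ D, HasDerivAt v (-(A s *ᵥ v s)) s) :
    MonotoneOn (fun s => exp (c * s) * (v s ⬝ᵥ v s)) D := by
  have hderiv : ∀ s ∈ D, HasDerivAt (fun s => exp (c * s) * (v s ⬝ᵥ v s))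
      (exp (c * s) * (c * (v s ⬝ᵥ v s) - 2 * (v s ⬝ᵥ A s *ᵥ v s))) s := by
    intro s hs
    have hexp : HasDerivAt (fun s => exp (c * s)) (exp (c * s) * c) s := by
      simpa using ((hasDerivAt_id s).const_mul c).exp
    have hnorm : HasDerivAt (fun s => v s ⬝ᵥ v s) (-2 * (v s ⬝ᵥ A s *ᵥ v s)) s := by
      have hi := hasDerivAt_pi.1 (hv s hs)
      refine (HasDerivAt.fun_sum fun i _ => (hi i).mul (hi i)).congr_deriv ?_
      simp only [dotProduct, Finset.mul_sum, Pi.neg_apply]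
      exact Finset.sum_congr rfl fun i _ => by ring
    exact (hexp.mul hnorm).congr_deriv (by ring)
  refine monotoneOn_of_hasDerivWithinAt_nonneg hD
    (fun s hs => (hderiv s hs).continuousAt.continuousWithinAt)
    (fun s hs => (hderiv s (interior_subset hs)).hasDerivWithinAt) fun s hs => ?_
  have := dotProduct_mulVec_le_of_posSemidef (hA s (interior_subset hs)) (v s)
  exact mul_nonneg (exp_pos _).le (by linarith)

/-- Exponential bound for the transpose of the backward matrix flow J′(s) = −J(s)·A(s),
J(T) = I, when the symmetric matrices A(s) satisfy A(s) ≤ (c/2)·I in the Loewner order. -/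
theorem matrix_flow_exponential_bound (n : ℕ) (hn : 1 ≤ n) (T c : ℝ) (hT : 0 < T)
    (A J : ℝ → Matrix (Fin n) (Fin n) ℝ)
    (hAcont : ContinuousOn A (Set.Icc 0 T))
    (hAsymm : ∀ s ∈ Set.Icc (0 : ℝ) T, (A s).IsSymm)
    (hApsd : ∀ s ∈ Set.Icc (0 : ℝ) T,
      ((c / 2) • (1 : Matrix (Fin n) (Fin n) ℝ) - A s).PosSemidef)
    (hJT : J T = 1)
    (hJderiv : ∀ s ∈ Set.Icc (0 : ℝ) T, ∀ i j,
      HasDerivAt (fun t => J t i j) ((-(J s * A s)) i j) s) :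
    ∀ s ∈ Set.Icc (0 : ℝ) T, ∀ y : Fin n → ℝ,
      ∑ i, ((J s)ᵀ.mulVec y i) ^ 2 ≤ Real.exp (c * (T - s)) * ∑ i, (y i) ^ 2 := by
  intro s hs y
  have hv : ∀ t ∈ Set.Icc (0 : ℝ) T,
      HasDerivAt (fun t => (J t)ᵀ *ᵥ y) (-(A t *ᵥ ((J t)ᵀ *ᵥ y))) t := by
    intro t ht
    refine hasDerivAt_pi.2 fun i => ?_
    refine (HasDerivAt.fun_sum (u := Finset.univ) fun j _ =>
      (hJderiv t ht j i).mul_const (y j)).congr_deriv ?_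
    have hJA : -(A t *ᵥ ((J t)ᵀ *ᵥ y)) = (-(J t * A t))ᵀ *ᵥ y := by
      rw [transpose_neg, transpose_mul, (hAsymm t ht).eq, neg_mulVec, mulVec_mulVec]
    rw [hJA]
    rfl
  have hmono := monotoneOn_exp_mul_dotProduct_self (convex_Icc 0 T) hApsd hv hs
    (Set.right_mem_Icc.2 hT.le) hs.2
  simp only [hJT, transpose_one, one_mulVec] at hmono
  simp only [pow_two]
  change (J s)ᵀ *ᵥ y ⬝ᵥ (J s)ᵀ *ᵥ y ≤ exp (c * (T - s)) * (y ⬝ᵥ y)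
  refine le_of_mul_le_mul_left (hmono.trans_eq ?_) (exp_pos (c * s))
  rw [← mul_assoc, ← exp_add]
  ring_nf
end
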